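/- arXiv:2203.17146 — 3 statements merged into one kernel-verified Lean document; each statement's English description precedes it below -/
import Mathlib

section
/- Let n ≥ 1 and k ≥ 1 and let x : Fin n → ℝ be agents on the real line. Then there exists a k-clustering Y : Fin k → ℝ that is a (1, k)-core clustering; that is, for every set S ⊆ Fin n with |S| ≥ n/k and every point y' ∈ ℝ, one has k·Σ_{i∈S} |x_i − y'| ≥ Σ_{i∈S} min_{j<k} |x_i − Y_j|. -/
/-- The cost of agent location `p` under the `k`-clustering `Y`:
the minimum distance from `p` to a center of `Y`. -/
noncomputable def clusterCost {X : Type*} [MetricSpace X] {k : ℕ} (Y : Fin k → X) (p : X) : ℝ :=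
  sInf (Set.range fun j => dist p (Y j))

theorem clusterCost_le' {k : ℕ} (Y : Fin k → ℝ) (p : ℝ) (j : Fin k) :
    clusterCost Y p ≤ |p - Y j| := by
  unfold clusterCost
  refine csInf_le (Set.finite_range _).bddBelow ⟨j, ?_⟩
  simp [Real.dist_eq]

theorem clusterCost_attained {k : ℕ} (hk : 0 < k) (Y : Fin k → ℝ) (p : ℝ) :
    ∃ j, clusterCost Y p = |p - Y j| := by
  have : Nonempty (Fin k) := ⟨⟨0, hk⟩⟩
  have h := (Set.range_nonempty fun j => dist p (Y j)).csInf_mem (Set.finite_range _)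
  obtain ⟨j, hj⟩ := h
  refine ⟨j, ?_⟩
  unfold clusterCost
  rw [← hj]
  simp [Real.dist_eq]

/-- Centers at quantiles: few agents have no center between them and a given point. -/
theorem exists_quantiles {n k : ℕ} (hn : 0 < n) (x : Fin n → ℝ) :
    ∃ Y : Fin k → ℝ, ∀ y' : ℝ, ∀ T : Finset (Fin n),
      (∀ i ∈ T, ∀ j, Y j ∉ Set.uIcc (x i) y') → T.card ≤ n / (k + 1) := by
  have hnm : n < (k + 1) * (n / (k + 1) + 1) := Nat.lt_mul_div_succ n (Nat.succ_pos k)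
  generalize n / (k + 1) = m at hnm ⊢
  have hmono : Monotone (x ∘ Tuple.sort x) := Tuple.monotone_sort x
  set z := x ∘ Tuple.sort x with hz
  refine ⟨fun t => z ⟨min (t * (m + 1) + m) (n - 1), by omega⟩, ?_⟩
  intro y' T hT
  by_contra! hcard
  set U : Finset (Fin n) := T.map (Tuple.sort x).symm.toEmbedding with hU
  have hUc : U.card = T.card := Finset.card_map _
  have hUz : ∀ p ∈ U, ∃ i ∈ T, x i = z p := by
    intro p hp
    rw [hU, Finset.mem_map] at hp
    obtain ⟨i, hi, rfl⟩ := hp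
    exact ⟨i, hi, by simp [hz]⟩
  have hne : U.Nonempty := by
    rw [← Finset.card_pos]; omega
  set p := U.min' hne
  set q := U.max' hne
  have hsub : U ⊆ Finset.Icc p q := fun a ha =>
    Finset.mem_Icc.2 ⟨U.min'_le a ha, U.le_max' a ha⟩
  have hle := Finset.card_le_card hsub
  rw [Fin.card_Icc] at hle
  have hpq : (p : ℕ) + m ≤ q := by omega
  have hqn : (q : ℕ) < n := q.2
  set t := (p : ℕ) / (m + 1) with ht
  have h1 : t * (m + 1) + (p : ℕ) % (m + 1) = p := Nat.div_add_mod' _ _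
  have h2 : (p : ℕ) % (m + 1) < m + 1 := Nat.mod_lt _ (Nat.succ_pos m)
  have htk : t < k := by
    by_contra! h
    have := Nat.mul_le_mul_right (m + 1) h
    have e : (k + 1) * (m + 1) = k * (m + 1) + (m + 1) := by ring
    omega
  have hmin : min (t * (m + 1) + m) (n - 1) = t * (m + 1) + m := by omega
  obtain ⟨i, hi, hip⟩ := hUz p (U.min'_mem hne)
  obtain ⟨i', hi', hiq⟩ := hUz q (U.max'_mem hne)
  have A := hT i hi ⟨t, htk⟩
  have B := hT i' hi' ⟨t, htk⟩
  rw [hip] at A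
  rw [hiq] at B
  have C : z p ≤ z ⟨min (t * (m + 1) + m) (n - 1), by omega⟩ :=
    hmono (by rw [Fin.le_def]; simp only; omega)
  have D : z ⟨min (t * (m + 1) + m) (n - 1), by omega⟩ ≤ z q :=
    hmono (by rw [Fin.le_def]; simp only; omega)
  rcases le_total y' (z ⟨min (t * (m + 1) + m) (n - 1), by omega⟩) with h | h
  · exact B (Set.mem_uIcc.2 (Or.inr ⟨h, D⟩))
  · exact A (Set.mem_uIcc.2 (Or.inl ⟨C, h⟩))

theorem stmt5 {n k : ℕ} (hn : 0 < n) (hk : 0 < k) (x : Fin n → ℝ) :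
    ∃ Y : Fin k → ℝ,
      ∀ S : Finset (Fin n), (n : ℝ) / (k : ℝ) ≤ S.card →
        ∀ y' : ℝ,
          ∑ i ∈ S, clusterCost Y (x i) ≤ (k : ℝ) * ∑ i ∈ S, |x i - y'| := by
  classical
  obtain ⟨Y, hY⟩ := exists_quantiles (k := k) hn x
  refine ⟨Y, fun S hS y' => ?_⟩
  set δ := clusterCost Y y' with hδ
  obtain ⟨j0, hj0⟩ := clusterCost_attained hk Y y'
  have hδ0 : 0 ≤ δ := by rw [hδ, hj0]; exact abs_nonneg _
  have hk1 : (1 : ℝ) ≤ k := by exact_mod_cast hk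
  let P : Fin n → Prop := fun i => ∀ j, Y j ∉ Set.uIcc (x i) y'
  have hin : ∀ i, clusterCost Y (x i) ≤ |x i - y'| + δ := by
    intro i
    have h1 := clusterCost_le' Y (x i) j0
    have h2 := abs_sub_le (x i) y' (Y j0)
    rw [hδ, hj0]; linarith
  have hout : ∀ i, ¬ P i → clusterCost Y (x i) + δ ≤ |x i - y'| := by
    intro i hi
    simp only [P, not_forall, not_not] at hi
    obtain ⟨j, hj⟩ := hi
    have h1 := clusterCost_le' Y (x i) j
    have h2 := clusterCost_le' Y y' j
    have h3 : |x i - y'| = |x i - Y j| + |y' - Y j| := by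
      rcases Set.mem_uIcc.1 hj with ⟨a, b⟩ | ⟨a, b⟩
      · rw [abs_of_nonpos (by linarith), abs_of_nonpos (by linarith),
          abs_of_nonneg (by linarith)]; ring
      · rw [abs_of_nonneg (by linarith), abs_of_nonneg (by linarith),
          abs_of_nonpos (by linarith)]; ring
    linarith
  have hcost0 : ∀ i, 0 ≤ clusterCost Y (x i) := by
    intro i
    obtain ⟨j, hj⟩ := clusterCost_attained hk Y (x i)
    rw [hj]; exact abs_nonneg _
  set I := S.filter P with hI
  set O := S.filter (fun i => ¬ P i) with hO
  have hcard : I.card + O.card = S.card := Finset.card_filter_add_card_filter_not _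
  have hIc : I.card ≤ n / (k + 1) := hY y' I (fun i hi => (Finset.mem_filter.1 hi).2)
  have hIk : (I.card : ℝ) ≤ k * O.card := by
    have h1 : I.card * (k + 1) ≤ n := (Nat.le_div_iff_mul_le (Nat.succ_pos k)).1 hIc
    have h2 : n ≤ S.card * k := by
      rw [div_le_iff₀ (by linarith)] at hS
      exact_mod_cast hS
    rw [← hcard] at h2
    have h3 : I.card ≤ k * O.card := by nlinarith
    exact_mod_cast h3
  rw [← Finset.sum_filter_add_sum_filter_not S P (fun i => clusterCost Y (x i)),
    ← Finset.sum_filter_add_sum_filter_not S P (fun i => |x i - y'|)]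
  have a1 : ∑ i ∈ I, clusterCost Y (x i) ≤ ∑ i ∈ I, |x i - y'| + I.card * δ := by
    have := Finset.sum_le_sum (s := I) (fun i _ => hin i)
    rwa [Finset.sum_add_distrib, Finset.sum_const, nsmul_eq_mul] at this
  have a2 : ∑ i ∈ O, clusterCost Y (x i) + O.card * δ ≤ ∑ i ∈ O, |x i - y'| := by
    have := Finset.sum_le_sum (s := O) (fun i hi => hout i (Finset.mem_filter.1 hi).2)
    rwa [Finset.sum_add_distrib, Finset.sum_const, nsmul_eq_mul] at this
  have a3 : 0 ≤ ∑ i ∈ O, clusterCost Y (x i) := Finset.sum_nonneg (fun i _ => hcost0 i)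
  have a4 : 0 ≤ ∑ i ∈ I, |x i - y'| := Finset.sum_nonneg (fun i _ => abs_nonneg _)
  have a5 : (I.card : ℝ) * δ ≤ k * O.card * δ := mul_le_mul_of_nonneg_right hIk hδ0
  have a6 := mul_le_mul_of_nonneg_left a2 (by linarith : (0 : ℝ) ≤ k)
  have a7 := mul_nonneg (sub_nonneg.2 hk1) a4
  have a8 := mul_nonneg (sub_nonneg.2 hk1) a3
  linarith
end

section
/- Let G be a finite connected acyclic simple graph (a tree) on vertex set V, with graph distance d(u,v) equal to the number of edges on the shortest u–v path (viewed as a real number). Let x : Fin n → V be agents at vertices with n ≥ 1 and k ≥ 1, and let M = V. Then there exists a k-clustering Y : Fin k → V that is a (1, k)-core clustering; that is, for every set S ⊆ Fin n with |S| ≥ n/k and every vertex y' ∈ V, one has k·Σ_{i∈S} d(x_i, y') ≥ Σ_{i∈S} min_{j<k} d(x_i, Y_j). -/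
/-- The cost of an agent located at vertex `p` under the `k`-clustering `Y` in a graph `G`:
the minimum graph distance from `p` to a center of `Y`, as a real number. -/
noncomputable def treeClusterCost {V : Type*} (G : SimpleGraph V) {k : ℕ}
    (Y : Fin k → V) (p : V) : ℝ :=
  sInf (Set.range fun j => (G.dist p (Y j) : ℝ))

section helpers
variable {V : Type*} {G : SimpleGraph V}

theorem tree_sep (hc : G.Connected) (ha : G.IsAcyclic) {r v y : V}
    (h : G.dist r y = G.dist r v + G.dist v y) (a : V) :
    G.dist r a = G.dist r v + G.dist v a ∨ G.dist a y = G.dist a v + G.dist v y := by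
  classical
  obtain ⟨p, hp⟩ := hc.exists_walk_length_eq_dist r a
  obtain ⟨q, hq⟩ := hc.exists_walk_length_eq_dist a y
  obtain ⟨s, hs⟩ := hc.exists_walk_length_eq_dist r v
  obtain ⟨t, ht⟩ := hc.exists_walk_length_eq_dist v y
  have hst : (s.append t).IsPath := by
    apply SimpleGraph.Walk.isPath_of_length_eq_dist
    rw [SimpleGraph.Walk.length_append]; omega
  have hu := ha.path_unique ⟨_, hst⟩ ⟨_, (p.append q).bypass_isPath⟩
  have hu' : s.append t = (p.append q).bypass := congrArg Subtype.val hu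
  have hv : v ∈ (p.append q).support := by
    apply SimpleGraph.Walk.support_bypass_subset_support
    rw [← hu', SimpleGraph.Walk.mem_support_append_iff]
    left; exact s.end_mem_support
  have key : ∀ {b c : V} (w : G.Walk b c), w.length = G.dist b c → v ∈ w.support →
      G.dist b c = G.dist b v + G.dist v c := by
    intro b c w hw hm
    have h1 := congrArg SimpleGraph.Walk.length (w.take_spec hm)
    rw [SimpleGraph.Walk.length_append] at h1
    have h2 := SimpleGraph.dist_le (w.takeUntil v hm)
    have h3 := SimpleGraph.dist_le (w.dropUntil v hm)
    have h4 := hc.dist_triangle (u := b) (v := v) (w := c)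
    omega
  rw [SimpleGraph.Walk.mem_support_append_iff] at hv
  rcases hv with hv | hv
  · left; exact key p hp hv
  · right; exact key q hq hv

theorem tree_child (hc : G.Connected) (ha : G.IsAcyclic) {r v y : V}
    (h : G.dist r y = G.dist r v + G.dist v y) (hne : y ≠ v) :
    ∃ w, G.dist r w = G.dist r v + 1 ∧ ∀ a, G.dist r a = G.dist r v + G.dist v a →
      G.dist r a = G.dist r w + G.dist w a ∨ G.dist a y = G.dist a v + G.dist v y := by
  obtain ⟨p, hp⟩ := hc.exists_walk_length_eq_dist v y
  cases p with
  | nil => exact absurd rfl hne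
  | @cons _ w _ hadj p =>
    rw [SimpleGraph.Walk.length_cons] at hp
    have h1 := SimpleGraph.dist_le p
    have hvw : G.dist v w = 1 := SimpleGraph.dist_eq_one_iff_adj.2 hadj
    have h2 := hc.dist_triangle (u := v) (v := w) (w := y)
    have h3 := hc.dist_triangle (u := r) (v := v) (w := w)
    have h4 := hc.dist_triangle (u := r) (v := w) (w := y)
    refine ⟨w, by omega, fun a hra => ?_⟩
    rcases tree_sep hc ha (r := r) (v := w) (y := y) (by omega) a with h5 | h5
    · exact Or.inl h5
    · have h6 : G.dist a v ≠ G.dist a w := (SimpleGraph.IsTree.mk hc ha).dist_ne_of_adj a hadj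
      have h7 := hc.dist_triangle (u := a) (v := w) (w := v)
      have h8 := hc.dist_triangle (u := a) (v := v) (w := w)
      have h9 := SimpleGraph.dist_comm (G := G) (u := v) (v := w)
      have h10 := SimpleGraph.dist_comm (G := G) (u := a) (v := w)
      have h11 := SimpleGraph.dist_comm (G := G) (u := a) (v := v)
      omega

open Classical in
theorem tree_centers [Fintype V] (hc : G.Connected) (ha : G.IsAcyclic) {n : ℕ} (x : Fin n → V)
    (q : ℕ) : ∀ (k : ℕ) (A : Finset (Fin n)), A.card ≤ q + k * (q + 1) →
    ∃ Y : Fin k → V, ∀ y, (A.filter fun i =>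
      ∀ j, G.dist (x i) y ≠ G.dist (x i) (Y j) + G.dist (Y j) y).card ≤ q := by
  intro k
  induction k with
  | zero =>
    intro A hA
    exact ⟨Fin.elim0, fun y => (Finset.card_filter_le _ _).trans (by omega)⟩
  | succ k ih =>
    intro A hA
    obtain ⟨r⟩ := hc.nonempty
    by_cases hq : A.card ≤ q
    · exact ⟨fun _ => r, fun y => (Finset.card_filter_le _ _).trans hq⟩
    let sub : V → Finset (Fin n) := fun v =>
      A.filter fun i => G.dist r (x i) = G.dist r v + G.dist v (x i)
    have hr : r ∈ (Finset.univ.filter fun v => q < (sub v).card) := by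
      simp [sub]; omega
    obtain ⟨v, hv, hmax⟩ := Finset.exists_max_image _ (fun v => G.dist r v) ⟨r, hr⟩
    simp only [Finset.mem_filter, Finset.mem_univ, true_and] at hv hmax
    have hcard : (A \ sub v).card + (sub v).card = A.card :=
      Finset.card_sdiff_add_card_eq_card (Finset.filter_subset _ _)
    obtain ⟨Y, hY⟩ := ih (A \ sub v) (by
      have : (k + 1) * (q + 1) = k * (q + 1) + (q + 1) := by ring
      omega)
    refine ⟨Fin.cons v Y, fun y => ?_⟩
    simp only [Fin.forall_fin_succ, Fin.cons_zero, Fin.cons_succ]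
    by_cases hy : G.dist r y = G.dist r v + G.dist v y
    · by_cases hyv : y = v
      · subst hyv; simp
      obtain ⟨w, hw, hw'⟩ := tree_child hc ha hy hyv
      have hwc : (sub w).card ≤ q := by
        by_contra hcon
        have := hmax w (by omega)
        omega
      refine (Finset.card_le_card ?_).trans hwc
      intro i hi
      simp only [Finset.mem_filter, sub] at hi ⊢
      refine ⟨hi.1, ?_⟩
      rcases tree_sep hc ha hy (x i) with h1 | h1
      · exact (hw' _ h1).resolve_right hi.2.1
      · exact absurd h1 hi.2.1
    · refine (Finset.card_le_card ?_).trans (hY y)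
      intro i hi
      simp only [Finset.mem_filter, sub, Finset.mem_sdiff] at hi ⊢
      refine ⟨⟨hi.1, fun h => ?_⟩, hi.2.2⟩
      rcases tree_sep hc ha h.2 y with h1 | h1
      · exact hy h1
      · apply hi.2.1
        rw [SimpleGraph.dist_comm, h1, add_comm, SimpleGraph.dist_comm (u := v),
          SimpleGraph.dist_comm (u := y)]

theorem tree_cost_le {k : ℕ} (Y : Fin k → V) (p : V) (j : Fin k) :
    treeClusterCost G Y p ≤ G.dist p (Y j) :=
  csInf_le (Set.finite_range _).bddBelow ⟨j, rfl⟩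

theorem tree_cost_attained {k : ℕ} (hk : 0 < k) (Y : Fin k → V) (p : V) :
    ∃ j, treeClusterCost G Y p = G.dist p (Y j) := by
  have : Nonempty (Fin k) := ⟨⟨0, hk⟩⟩
  obtain ⟨j, hj⟩ := (Set.range_nonempty (fun j => (G.dist p (Y j) : ℝ))).csInf_mem
    (Set.finite_range _)
  exact ⟨j, hj.symm⟩

end helpers

theorem stmt7 {V : Type*} [Fintype V] (G : SimpleGraph V)
    (hGconn : G.Connected) (hGacyc : G.IsAcyclic)
    {n k : ℕ} (hn : 0 < n) (hk : 0 < k) (x : Fin n → V) :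
    ∃ Y : Fin k → V,
      ∀ S : Finset (Fin n), (n : ℝ) / (k : ℝ) ≤ S.card →
        ∀ y' : V,
          ∑ i ∈ S, treeClusterCost G Y (x i) ≤
            (k : ℝ) * ∑ i ∈ S, (G.dist (x i) y' : ℝ) := by
  classical
  have hdiv := Nat.div_add_mod n (k + 1)
  have hmod := (Nat.mod_lt n (Nat.succ_pos k) : n % (k + 1) < k + 1)
  obtain ⟨Y, hY⟩ := tree_centers hGconn hGacyc x (n / (k + 1)) k Finset.univ (by
    simp only [Finset.card_univ, Fintype.card_fin]
    generalize n / (k + 1) = q at *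
    have : (k + 1) * q = k * q + q := by ring
    have : k * (q + 1) = k * q + k := by ring
    omega)
  refine ⟨Y, fun S hS y => ?_⟩
  have hk' : (0 : ℝ) < k := by exact_mod_cast hk
  rw [div_le_iff₀ hk'] at hS
  have hS' : n ≤ S.card * k := by exact_mod_cast hS
  let P : Fin n → Prop := fun i =>
    ∀ j, G.dist (x i) y ≠ G.dist (x i) (Y j) + G.dist (Y j) y
  have hin : (S.filter P).card ≤ n / (k + 1) :=
    (Finset.card_le_card (Finset.filter_subset_filter _ (Finset.subset_univ S))).trans (hY y)
  have hsplit : (S.filter P).card + (S.filter fun i => ¬ P i).card = S.card :=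
    Finset.card_filter_add_card_filter_not _
  have hcount : (S.filter P).card ≤ k * (S.filter fun i => ¬ P i).card := by
    have h1 : (k + 1) * (S.filter P).card ≤ n :=
      (Nat.mul_le_mul_left _ hin).trans (Nat.mul_div_le _ _)
    rw [← hsplit] at hS'
    nlinarith
  obtain ⟨j0, hj0⟩ := tree_cost_attained (G := G) hk Y y
  set D : ℝ := treeClusterCost G Y y with hD
  have hD0 : 0 ≤ D := by rw [hj0]; positivity
  have hcin : ∀ i ∈ S.filter P, treeClusterCost G Y (x i) ≤ G.dist (x i) y + D := by
    intro i _
    refine (tree_cost_le Y _ j0).trans ?_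
    rw [hj0]
    exact_mod_cast hGconn.dist_triangle
  have hcout : ∀ i ∈ S.filter (fun i => ¬ P i),
      treeClusterCost G Y (x i) ≤ G.dist (x i) y - D ∧ D ≤ G.dist (x i) y := by
    intro i hi
    have h := (Finset.mem_filter.1 hi).2
    simp only [P, not_forall, not_not] at h
    obtain ⟨j, hj⟩ := h
    have h1 := tree_cost_le (G := G) Y (x i) j
    have h2 := tree_cost_le (G := G) Y y j
    rw [SimpleGraph.dist_comm] at h2
    have h3 : (G.dist (x i) y : ℝ) = G.dist (x i) (Y j) + G.dist (Y j) y := by exact_mod_cast hj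
    have h4 : (0 : ℝ) ≤ G.dist (x i) (Y j) := by positivity
    constructor <;> linarith
  have s1 := Finset.sum_le_sum hcin
  have s2 := Finset.sum_le_sum (fun i hi => (hcout i hi).1)
  have s3 := Finset.sum_le_sum (fun i hi => (hcout i hi).2)
  rw [Finset.sum_add_distrib, Finset.sum_const, nsmul_eq_mul] at s1
  rw [Finset.sum_sub_distrib, Finset.sum_const, nsmul_eq_mul] at s2
  rw [Finset.sum_const, nsmul_eq_mul] at s3
  rw [← Finset.sum_filter_add_sum_filter_not S P (fun i => treeClusterCost G Y (x i)),
    ← Finset.sum_filter_add_sum_filter_not S P (fun i => (G.dist (x i) y : ℝ))]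
  have s4 : (0 : ℝ) ≤ ∑ i ∈ S.filter P, (G.dist (x i) y : ℝ) :=
    Finset.sum_nonneg fun i _ => by positivity
  have hk1 : (1 : ℝ) ≤ k := by exact_mod_cast hk
  have hcount' : ((S.filter P).card : ℝ) ≤ k * ((S.filter fun i => ¬ P i).card : ℝ) := by
    exact_mod_cast hcount
  have s5 := mul_le_mul_of_nonneg_right hcount' hD0
  have s6 := mul_le_mul_of_nonneg_left s3 (sub_nonneg.2 hk1)
  have s7 := mul_nonneg (sub_nonneg.2 hk1) s4
  linarith
end

section
/- Let G be a finite connected acyclic simple graph (a tree) on vertex set V, with graph distance d(u,v) equal to the number of edges on the shortest u–v path (viewed as a real number). Let x : Fin n → V be agents at vertices with n ≥ 1, let k ≥ 1, let M = V, and let α > 1 be a real number. Set β = max{1, 1/(α − 1)}. Then there exists a k-clustering Y : Fin k → V that is an (α, β)-core clustering; that is, for every set S ⊆ Fin n with |S| ≥ α·n/k and every vertex y' ∈ V, one has β·Σ_{i∈S} d(x_i, y') ≥ Σ_{i∈S} min_{j<k} d(x_i, Y_j). -/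
/-- In a rooted tree, a non-root vertex `v` has a parent `u` through which it reaches
every other vertex of at most the same depth. -/
theorem tree_parent {V : Type*} (G : SimpleGraph V)
    (hGconn : G.Connected) (hGacyc : G.IsAcyclic) (r v : V) (hv : v ≠ r) :
    ∃ u, G.dist r u < G.dist r v ∧
      ∀ b, b ≠ v → G.dist r b ≤ G.dist r v → G.dist v b = 1 + G.dist u b := by
  classical
  have huniq : ∀ {a b : V} (p : G.Walk a b), p.IsPath → p.length = G.dist a b := by
    intro a b p hp
    obtain ⟨q, hq, hql⟩ := hGconn.exists_path_of_dist a b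
    have := (hGacyc.subsingleton_path a b).elim ⟨p, hp⟩ ⟨q, hq⟩
    rw [← hql]
    exact congrArg (fun z : G.Path a b => z.1.length) this
  have hlt : ∀ {b : V} (q : G.Walk r b), q.length = G.dist r b → ∀ z ∈ q.support, z ≠ b →
      G.dist r z < G.dist r b := by
    intro b q hq z hz hzb
    have h1 := G.dist_le (q.takeUntil z hz)
    have h2 := congrArg SimpleGraph.Walk.length (q.take_spec hz)
    rw [SimpleGraph.Walk.length_append] at h2
    have h3 : (q.dropUntil z hz).length ≠ 0 := fun h =>
      hzb (SimpleGraph.Walk.eq_of_length_eq_zero h)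
    omega
  obtain ⟨p, hp, hpl⟩ := hGconn.exists_path_of_dist v r
  cases p with
  | nil => exact absurd rfl hv
  | cons hadj p' =>
    rename_i u
    have hu : G.dist r u < G.dist r v := by
      have := G.dist_le p'
      rw [SimpleGraph.Walk.length_cons] at hpl
      rw [G.dist_comm (u := r), G.dist_comm (u := r)]; omega
    refine ⟨u, hu, fun b hb hbd => ?_⟩
    obtain ⟨q, hq, hql⟩ := hGconn.exists_path_of_dist r b
    have hvp : v ∉ p'.support := by
      rw [SimpleGraph.Walk.cons_isPath_iff] at hp; exact hp.2
    have hvq : v ∉ q.support := fun h => by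
      have := hlt q hql v h hb.symm
      omega
    have hvw : v ∉ (p'.append q).bypass.support := fun h => by
      have := (p'.append q).support_bypass_subset_support h
      rw [SimpleGraph.Walk.mem_support_append_iff] at this
      exact this.elim hvp hvq
    have hP := (p'.append q).bypass_isPath
    have h1 := huniq _ hP
    have h2 := huniq (SimpleGraph.Walk.cons hadj (p'.append q).bypass)
      ((SimpleGraph.Walk.cons_isPath_iff _ _).2 ⟨hP, hvw⟩)
    rw [SimpleGraph.Walk.length_cons] at h2
    omega

/-- Greedy bottom-up choice of centers. -/
theorem tree_centers_s18 {V : Type*} [DecidableEq V] (G : SimpleGraph V)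
    (hGconn : G.Connected) (hGacyc : G.IsAcyclic) (r : V) (t : ℕ) (A : Finset V) :
    (∀ v ∈ A, ∀ u, G.dist r u < G.dist r v → u ∈ A) → ∀ w : V → ℕ,
      ∃ C ⊆ A, C.card * t ≤ ∑ v ∈ A, w v ∧ ∀ y ∈ A, y ∉ C → ∀ B ⊆ A,
        (∀ v ∈ B, ∀ c ∈ C, G.dist v y ≠ G.dist v c + G.dist c y) → ∑ v ∈ B, w v < t := by
  classical
  induction A using Finset.induction_on_max_value (f := fun v => G.dist r v) with
  | empty => intro _ w; exact ⟨∅, by simp⟩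
  | insert a s ha hmax ih =>
    intro hcl w
    have hcl' : ∀ v ∈ s, ∀ u, G.dist r u < G.dist r v → u ∈ s := by
      intro v hv u hu
      rcases Finset.mem_insert.1 (hcl v (Finset.mem_insert_of_mem hv) u hu) with h | h
      · subst h; have := hmax v hv; omega
      · exact h
    have ih := ih hcl'
    have haB : ∀ B ⊆ insert a s, ∀ w : V → ℕ, a ∉ B → B ⊆ s := by
      intro B hB w haB v hv
      rcases Finset.mem_insert.1 (hB hv) with h | h
      · subst h; exact absurd hv haB
      · exact h
    by_cases hwa : t ≤ w a
    · obtain ⟨C, hCs, hCt, hC⟩ := ih w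
      have haC : a ∉ C := fun h => ha (hCs h)
      refine ⟨insert a C, Finset.insert_subset_insert a hCs, ?_, ?_⟩
      · rw [Finset.card_insert_of_notMem haC, Finset.sum_insert ha]
        linarith [add_mul C.card 1 t]
      · intro y hy hyC B hB hsep
        simp only [Finset.mem_insert, not_or] at hyC hy
        refine hC y (hy.resolve_left hyC.1) hyC.2 B (haB B hB w ?_)
          (fun v hv c hc => hsep v hv c (Finset.mem_insert_of_mem hc))
        intro haB
        exact hsep a haB a (Finset.mem_insert_self _ _) (by simp)
    · push Not at hwa
      by_cases har : a = r
      · have hs : s = ∅ := by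
          rw [Finset.eq_empty_iff_forall_notMem]
          intro v hv
          have h1 := hmax v hv
          have h2 : G.dist r v = 0 := by
            rw [har, SimpleGraph.dist_self] at h1; omega
          have h3 : r = v := hGconn.dist_eq_zero_iff.1 h2
          exact ha (by rw [har, h3]; exact hv)
        subst hs
        refine ⟨∅, by simp, by simp, ?_⟩
        intro y _ _ B hB _
        refine lt_of_le_of_lt (Finset.sum_le_sum_of_subset hB) ?_
        simpa using hwa
      · obtain ⟨u, hu, hub⟩ := tree_parent G hGconn hGacyc r a har
        have hus : u ∈ s := by
          rcases Finset.mem_insert.1 (hcl a (Finset.mem_insert_self _ _) u hu) with h | h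
          · subst h; omega
          · exact h
        have hd : ∀ b ∈ s, G.dist a b = 1 + G.dist u b := fun b hb =>
          hub b (fun h => ha (h ▸ hb)) (hmax b hb)
        have hd' : ∀ b ∈ s, G.dist b a = 1 + G.dist b u := fun b hb => by
          rw [G.dist_comm (u := b), G.dist_comm (u := b), hd b hb]
        have hua : G.dist u a = 1 := by rw [hd' u hus]; simp
        obtain ⟨C, hCs, hCt, hC⟩ := ih (fun v => w v + if v = u then w a else 0)
        have hsum : ∀ B : Finset V, u ∈ B →
            ∑ v ∈ B, (w v + if v = u then w a else 0) = ∑ v ∈ B, w v + w a := by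
          intro B hB
          rw [Finset.sum_add_distrib, Finset.sum_ite_eq' B u, if_pos hB]
        refine ⟨C, hCs.trans (Finset.subset_insert _ _), ?_, ?_⟩
        · rw [Finset.sum_insert ha]
          rw [hsum s hus] at hCt; omega
        · intro y hy hyC B hB hsep
          have hBe : B.erase a ⊆ s := haB _ ((Finset.erase_subset _ _).trans hB) w (by simp)
          have hle : ∑ v ∈ B, w v ≤ ∑ v ∈ insert u (B.erase a), w v + w a := by
            calc ∑ v ∈ B, w v ≤ ∑ v ∈ insert a (B.erase a), w v :=
                  Finset.sum_le_sum_of_subset (fun v hv => by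
                    by_cases h : v = a <;> simp [h, hv])
              _ = w a + ∑ v ∈ B.erase a, w v := Finset.sum_insert (by simp)
              _ ≤ w a + ∑ v ∈ insert u (B.erase a), w v :=
                  Nat.add_le_add_left (Finset.sum_le_sum_of_subset (Finset.subset_insert _ _)) _
              _ = _ := add_comm _ _
          have hins : insert u (B.erase a) ⊆ s := Finset.insert_subset hus hBe
          rcases Finset.mem_insert.1 hy with hya | hys
          · subst hya
            by_cases huC : u ∈ C
            · have hBa : B ⊆ {y} := by
                intro v hv
                by_contra hvy
                have hvs : v ∈ s := hBe (Finset.mem_erase.2 ⟨by simpa using hvy, hv⟩)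
                refine hsep v hv u huC ?_
                rw [hd' v hvs, hua, add_comm]
              refine lt_of_le_of_lt (Finset.sum_le_sum_of_subset hBa) ?_
              simpa using hwa
            · have := hC u hus huC _ hins ?_
              · rw [hsum _ (Finset.mem_insert_self _ _)] at this
                omega
              · intro v hv c hc h
                rcases Finset.mem_insert.1 hv with hvu | hvB
                · subst hvu
                  rw [SimpleGraph.dist_self] at h
                  have h0 : G.dist v c = 0 := by omega
                  have := hGconn.dist_eq_zero_iff.1 h0
                  exact huC (this ▸ hc)
                · refine hsep v (Finset.mem_of_mem_erase hvB) c hc ?_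
                  rw [hd' v (hBe hvB), hd' c (hCs hc), h]; omega
          · by_cases haB' : a ∈ B
            · have := hC y hys hyC _ hins ?_
              · rw [hsum _ (Finset.mem_insert_self _ _)] at this
                omega
              · intro v hv c hc h
                rcases Finset.mem_insert.1 hv with hvu | hvB
                · subst hvu
                  refine hsep a haB' c hc ?_
                  rw [hd y hys, hd c (hCs hc), h]; omega
                · exact hsep v (Finset.mem_of_mem_erase hvB) c hc h
            · refine lt_of_le_of_lt (Finset.sum_le_sum (fun v _ => Nat.le_add_right _ _))
                (hC y hys hyC B (haB B hB w haB') hsep)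

theorem stmt18 {V : Type*} [Fintype V] (G : SimpleGraph V)
    (hGconn : G.Connected) (hGacyc : G.IsAcyclic)
    {n k : ℕ} (hn : 0 < n) (hk : 0 < k) (x : Fin n → V)
    (α : ℝ) (hα : 1 < α) :
    ∃ Y : Fin k → V,
      ∀ S : Finset (Fin n), α * (n : ℝ) / (k : ℝ) ≤ S.card →
        ∀ y' : V,
          ∑ i ∈ S, treeClusterCost G Y (x i) ≤
            max 1 (1 / (α - 1)) * ∑ i ∈ S, (G.dist (x i) y' : ℝ) := by
  classical
  have hkR : (0 : ℝ) < k := by exact_mod_cast hk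
  have hnR : (0 : ℝ) < n := by exact_mod_cast hn
  set r : V := x ⟨0, hn⟩
  set t : ℕ := ⌈(n : ℝ) / k⌉₊ with ht
  obtain ⟨C, -, hCt, hC⟩ := tree_centers_s18 G hGconn hGacyc r t Finset.univ (by simp)
    (fun v => (Finset.univ.filter (fun i => x i = v)).card)
  have hw : ∀ P : V → Prop, ∑ v ∈ Finset.univ.filter P,
      (Finset.univ.filter (fun i => x i = v)).card
        = (Finset.univ.filter (fun i => P (x i))).card := by
    intro P
    rw [Finset.card_eq_sum_card_fiberwise (f := x) (t := Finset.univ.filter P)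
      (fun i hi => by simpa using hi)]
    refine Finset.sum_congr rfl fun v hv => ?_
    congr 1
    ext i
    simp only [Finset.mem_filter, Finset.mem_univ, true_and] at hv ⊢
    constructor
    · rintro rfl; exact ⟨hv, rfl⟩
    · exact fun h => h.2
  have hcomp : ∀ y ∉ C, ((Finset.univ.filter (fun i =>
      ∀ c ∈ C, G.dist (x i) y ≠ G.dist (x i) c + G.dist c y)).card : ℝ) < n / k := by
    intro y hy
    have := hC y (Finset.mem_univ _) hy (Finset.univ.filter
      (fun v => ∀ c ∈ C, G.dist v y ≠ G.dist v c + G.dist c y)) (Finset.subset_univ _)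
      (fun v hv => (Finset.mem_filter.1 hv).2)
    have h2 := hw (fun v => ∀ c ∈ C, G.dist v y ≠ G.dist v c + G.dist c y)
    have h3 : (Finset.univ.filter (fun i =>
        ∀ c ∈ C, G.dist (x i) y ≠ G.dist (x i) c + G.dist c y)).card < t := by
      refine lt_of_le_of_lt (le_of_eq ?_) this
      convert h2.symm using 2 <;> (ext; simp only [Finset.mem_filter])
    exact Nat.lt_ceil.1 h3
  have hne : C.Nonempty := by
    rw [Finset.nonempty_iff_ne_empty]
    rintro rfl
    have := hcomp r (by simp)
    simp only [Finset.notMem_empty, false_imp_iff, implies_true, Finset.filter_true,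
      Finset.card_univ, Fintype.card_fin] at this
    rw [lt_div_iff₀ hkR] at this
    have h1 : (1 : ℝ) ≤ k := by exact_mod_cast hk
    nlinarith
  have hCk : C.card ≤ k := by
    have h1 := hw (fun _ => True)
    simp only [Finset.filter_true, Finset.card_univ, Fintype.card_fin] at h1
    rw [h1] at hCt
    have h2 : (C.card : ℝ) * t ≤ n := by exact_mod_cast hCt
    have h3 : (n : ℝ) / k ≤ t := Nat.le_ceil _
    have h4 : (C.card : ℝ) * (n / k) ≤ n := le_trans (by gcongr) h2
    have h5 : (C.card : ℝ) ≤ k := by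
      rw [← mul_div_assoc, div_le_iff₀ hkR] at h4
      nlinarith
    exact_mod_cast h5
  obtain ⟨Y, hY⟩ : ∃ Y : Fin k → V, ∀ v, v ∈ C ↔ ∃ j, Y j = v := by
    obtain ⟨c0, hc0⟩ := hne
    obtain ⟨e⟩ : Nonempty (C ↪ Fin k) := by
      rw [Function.Embedding.nonempty_iff_card_le]; simpa using hCk
    have : Nonempty C := ⟨⟨c0, hc0⟩⟩
    refine ⟨fun j => (Function.invFun e j : C), fun v => ⟨fun hv => ⟨e ⟨v, hv⟩, ?_⟩, ?_⟩⟩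
    · simp only [Function.leftInverse_invFun e.injective _]
    · rintro ⟨j, rfl⟩; exact (Function.invFun e j).2
  have hcle : ∀ p, ∀ c ∈ C, treeClusterCost G Y p ≤ G.dist p c := by
    intro p c hc
    obtain ⟨j, rfl⟩ := (hY c).1 hc
    exact csInf_le (Set.finite_range _).bddBelow ⟨j, rfl⟩
  have hcex : ∀ p, ∃ c ∈ C, treeClusterCost G Y p = G.dist p c := by
    intro p
    have : Nonempty (Fin k) := ⟨⟨0, hk⟩⟩
    obtain ⟨j, hj⟩ := (Set.range_nonempty fun j => (G.dist p (Y j) : ℝ)).csInf_mem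
      (Set.finite_range _)
    exact ⟨Y j, (hY _).2 ⟨j, rfl⟩, hj.symm⟩
  refine ⟨Y, fun S hS y => ?_⟩
  set β := max 1 (1 / (α - 1)) with hβ
  have hβ1 : 1 ≤ β := le_max_left _ _
  have hT0 : 0 ≤ ∑ i ∈ S, (G.dist (x i) y : ℝ) := Finset.sum_nonneg fun i _ => by positivity
  by_cases hy : y ∈ C
  · calc _ ≤ ∑ i ∈ S, (G.dist (x i) y : ℝ) := Finset.sum_le_sum fun i _ => hcle _ _ hy
      _ ≤ _ := le_mul_of_one_le_left hT0 hβ1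
  · obtain ⟨c1, hc1, hD⟩ := hcex y
    set D := treeClusterCost G Y y
    have hD0 : 0 ≤ D := by rw [hD]; positivity
    set P : Fin n → Prop := fun i => ∀ c ∈ C, G.dist (x i) y ≠ G.dist (x i) c + G.dist c y
      with hP
    have hin : ∀ i, treeClusterCost G Y (x i) ≤ G.dist (x i) y + D := by
      intro i
      refine (hcle (x i) c1 hc1).trans ?_
      rw [hD]
      exact_mod_cast hGconn.dist_triangle
    have hout : ∀ i, ¬ P i → treeClusterCost G Y (x i) ≤ G.dist (x i) y - D ∧
        D ≤ G.dist (x i) y := by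
      intro i hi
      simp only [hP, not_forall, not_not] at hi
      obtain ⟨c, hc, h⟩ := hi
      have h1 := hcle (x i) c hc
      have h2 := hcle y c hc
      rw [G.dist_comm] at h2
      have h3 : (G.dist (x i) y : ℝ) = G.dist (x i) c + G.dist c y := by exact_mod_cast h
      have h4 : (0 : ℝ) ≤ G.dist (x i) c := by positivity
      constructor
      · linarith
      · linarith
    have ha : ((S.filter P).card : ℝ) < n / k := by
      refine lt_of_le_of_lt ?_ (hcomp y hy)
      exact_mod_cast Finset.card_le_card (Finset.filter_subset_filter _ (Finset.subset_univ _))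
    have hab : ((S.filter P).card : ℝ) + (S.filter (fun i => ¬ P i)).card = S.card := by
      exact_mod_cast Finset.card_filter_add_card_filter_not (s := S) P
    have e1 := Finset.sum_filter_add_sum_filter_not S P
      (fun i => treeClusterCost G Y (x i))
    have e2 := Finset.sum_filter_add_sum_filter_not S P (fun i => (G.dist (x i) y : ℝ))
    have i1 : ∑ i ∈ S.filter P, treeClusterCost G Y (x i) ≤
        ∑ i ∈ S.filter P, (G.dist (x i) y : ℝ) + (S.filter P).card * D := by
      rw [← nsmul_eq_mul, ← Finset.sum_const, ← Finset.sum_add_distrib]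
      exact Finset.sum_le_sum fun i _ => hin i
    have i2 : ∑ i ∈ S.filter (fun i => ¬ P i), treeClusterCost G Y (x i) ≤
        ∑ i ∈ S.filter (fun i => ¬ P i), (G.dist (x i) y : ℝ)
          - (S.filter (fun i => ¬ P i)).card * D := by
      rw [← nsmul_eq_mul, ← Finset.sum_const, ← Finset.sum_sub_distrib]
      exact Finset.sum_le_sum fun i hi => (hout i (Finset.mem_filter.1 hi).2).1
    have i3 : (S.filter (fun i => ¬ P i)).card * D ≤
        ∑ i ∈ S.filter (fun i => ¬ P i), (G.dist (x i) y : ℝ) := by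
      rw [← nsmul_eq_mul, ← Finset.sum_const]
      exact Finset.sum_le_sum fun i hi => (hout i (Finset.mem_filter.1 hi).2).2
    have i4 : 0 ≤ ∑ i ∈ S.filter P, (G.dist (x i) y : ℝ) :=
      Finset.sum_nonneg fun i _ => by positivity
    rw [← e1]
    rw [← e2] at hT0 ⊢
    generalize ∑ i ∈ S.filter P, treeClusterCost G Y (x i) = c1 at *
    generalize ∑ i ∈ S.filter (fun i => ¬ P i), treeClusterCost G Y (x i) = c2 at *
    generalize ∑ i ∈ S.filter P, (G.dist (x i) y : ℝ) = d1 at *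
    generalize ∑ i ∈ S.filter (fun i => ¬ P i), (G.dist (x i) y : ℝ) = d2 at *
    generalize ((S.filter P).card : ℝ) = a at *
    generalize ((S.filter (fun i => ¬ P i)).card : ℝ) = b at *
    rw [mul_div_assoc] at hS
    have hα0 : 0 < α - 1 := by linarith
    have hb : a * (α - 1) ≤ b := by nlinarith
    have hβ2 : 1 ≤ β * (α - 1) := by
      have : 1 / (α - 1) ≤ β := le_max_right _ _
      rwa [div_le_iff₀ hα0] at this
    have hb0 : a ≤ β * b := by
      by_cases h0 : 0 ≤ a
      · calc a ≤ (β * (α - 1)) * a := le_mul_of_one_le_left h0 hβ2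
          _ = β * (a * (α - 1)) := by ring
          _ ≤ β * b := by gcongr
      · have : 0 < b := by
          have : 0 < α * ((n : ℝ) / k) := by positivity
          linarith
        have : 0 ≤ β * b := by positivity
        linarith
    have k1 : a * D ≤ β * b * D := mul_le_mul_of_nonneg_right hb0 hD0
    have k2 : (β - 1) * (b * D) ≤ (β - 1) * (d1 + d2) :=
      mul_le_mul_of_nonneg_left (by linarith) (by linarith)
    nlinarith
end
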